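/- Let μ, κ, γ, M₀, T₀ > 0, let (P,γ) be an admissible pair with pressure potential W, and let (ρ,u,c) be a smooth periodic solution of the non-local Navier–Stokes–Korteweg system on [0,T₀) with initial data (ρ₀,u₀) satisfying M₀⁻¹ ≤ ρ₀(x) ≤ M₀ for all x. Then there exists a constant C(T₀) > 0, depending only on ‖ρ₀‖_{H¹(𝕋)}, ‖u₀‖_{H¹(𝕋)}, M₀, μ, κ, γ, W and T₀, such that for all t ∈ [0,T₀): ∫₀¹ [ (1/2)·ρ·|u + ∂_x(φ(ρ))|² + W(ρ) + (γ/2)·|ρ − c|² + (κ/2)·|∂_x c|² ](t,x) dx + ∫₀^t ∫₀¹ ∂_x(φ(ρ))·∂_x(P_γ(ρ)) dx dτ ≤ C(T₀), where φ(r) := ∫₁^r μ/s² ds and P_γ(r) := P(r) + (γ/2)·r². In particular, sup_{t∈[0,T₀)} ‖∂_x( ρ(t,·)^{−1/2} )‖_{L²(𝕋)} ≤ C(T₀). -/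

import Mathlib

open MeasureTheory Filter Set

/-- The `L²` norm of a `1`-periodic function, computed over one period. -/
noncomputable def L2norm (f : ℝ → ℝ) : ℝ := Real.sqrt (∫ x in (0:ℝ)..1, f x ^ 2)

/-- The `H¹` norm of a `1`-periodic function, computed over one period. -/
noncomputable def H1norm (f : ℝ → ℝ) : ℝ :=
  Real.sqrt (∫ x in (0:ℝ)..1, f x ^ 2 + deriv f x ^ 2)

/-- The `H²` norm of a `1`-periodic function, computed over one period. -/
noncomputable def H2norm (f : ℝ → ℝ) : ℝ :=
  Real.sqrt (∫ x in (0:ℝ)..1, f x ^ 2 + deriv f x ^ 2 + deriv (deriv f) x ^ 2)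

/-- The sup-norm of a `1`-periodic function, computed over one period. -/
noncomputable def LinfNorm (f : ℝ → ℝ) : ℝ := sSup ((fun x => |f x|) '' Set.Icc (0:ℝ) 1)

/-- The `W^{1,∞}` norm of a `1`-periodic function. -/
noncomputable def W1infNorm (f : ℝ → ℝ) : ℝ := LinfNorm f + LinfNorm (deriv f)

/-- The artificial pressure `P_γ(r) = P(r) + (γ/2) r²`. -/
noncomputable def artificialPressure (P : ℝ → ℝ) (γ : ℝ) (r : ℝ) : ℝ := P r + γ / 2 * r ^ 2

/-- A pair `(P, γ)` is admissible (with exponent `β` and limit `a`). -/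
structure IsAdmissiblePair (P : ℝ → ℝ) (γ β a : ℝ) : Prop where
  gamma_pos : 0 < γ
  beta_ge : 2 ≤ β
  a_pos : 0 < a
  nonneg : ∀ r, 0 ≤ r → 0 ≤ P r
  smooth : ContDiffOn ℝ 1 P (Set.Ici 0)
  zero : P 0 = 0
  lim : Filter.Tendsto (fun r => deriv P r / r ^ (β - 1)) Filter.atTop (nhds a)
  mono : MonotoneOn (artificialPressure P γ) (Set.Ici 0)

/-- `W` is a pressure potential for `P`: `W : [0,∞) → [0,∞)`, twice continuously
differentiable on `(0,∞)`, with `W''(r)·r = P'(r)` for `r > 0`. -/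
structure IsPressurePotential (P W : ℝ → ℝ) : Prop where
  nonneg : ∀ r, 0 ≤ r → 0 ≤ W r
  smooth : ContDiffOn ℝ 2 W (Set.Ioi 0)
  relation : ∀ r : ℝ, 0 < r → deriv (deriv W) r * r = deriv P r

/-- A smooth `1`-periodic-in-space solution of the non-local Navier–Stokes–Korteweg
system on the time set `S`, with initial data `(ρ₀, u₀)`. -/
structure IsNSKSolution (μ κ γ : ℝ) (P : ℝ → ℝ) (S : Set ℝ)
    (ρ u c : ℝ → ℝ → ℝ) (ρ₀ u₀ : ℝ → ℝ) : Prop where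
  smooth_rho : ContDiffOn ℝ (⊤ : ℕ∞) (fun p : ℝ × ℝ => ρ p.1 p.2) (S ×ˢ (Set.univ : Set ℝ))
  smooth_u : ContDiffOn ℝ (⊤ : ℕ∞) (fun p : ℝ × ℝ => u p.1 p.2) (S ×ˢ (Set.univ : Set ℝ))
  smooth_c : ContDiffOn ℝ (⊤ : ℕ∞) (fun p : ℝ × ℝ => c p.1 p.2) (S ×ˢ (Set.univ : Set ℝ))
  periodic_rho : ∀ t x, ρ t (x + 1) = ρ t x
  periodic_u : ∀ t x, u t (x + 1) = u t x
  periodic_c : ∀ t x, c t (x + 1) = c t x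
  rho_pos : ∀ t x, 0 < ρ t x
  mass : ∀ t ∈ S, ∀ x : ℝ,
    deriv (fun s => ρ s x) t + deriv (fun y => ρ t y * u t y) x = 0
  momentum : ∀ t ∈ S, ∀ x : ℝ,
    deriv (fun s => ρ s x * u s x) t
      + deriv (fun y => ρ t y * u t y ^ 2) x
      + deriv (fun y => P (ρ t y)) x
      - μ * deriv (deriv (u t)) x
      - γ * ρ t x * deriv (fun y => c t y - ρ t y) x = 0
  elliptic : ∀ t ∈ S, ∀ x : ℝ,
    -κ * deriv (deriv (c t)) x + γ * (c t x - ρ t x) = 0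
  init_rho : ∀ x, ρ 0 x = ρ₀ x
  init_u : ∀ x, u 0 x = u₀ x

/-- The partial derivative in the second variable. -/
noncomputable def spaceDeriv (f : ℝ × ℝ → ℝ) (p : ℝ × ℝ) : ℝ := deriv (fun y => f (p.1, y)) p.2

/-- The partial derivative in the first variable. -/
noncomputable def timeDeriv (f : ℝ × ℝ → ℝ) (p : ℝ × ℝ) : ℝ := deriv (fun s => f (s, p.2)) p.1

section Calculus

variable {S : Set ℝ} {f : ℝ × ℝ → ℝ}

theorem hasDerivAt_space_fderivWithin (hf : ContDiffOn ℝ (⊤ : ℕ∞) f (S ×ˢ univ)) {t : ℝ}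
    (ht : t ∈ S) (x : ℝ) :
    HasDerivAt (fun y => f (t, y)) (fderivWithin ℝ f (S ×ˢ univ) (t, x) (0, 1)) x := by
  have h1 : HasFDerivWithinAt f (fderivWithin ℝ f (S ×ˢ univ) (t, x)) (S ×ˢ univ) (t, x) :=
    ((hf.differentiableOn (by simp)) (t, x) ⟨ht, mem_univ _⟩).hasFDerivWithinAt
  have h2 : HasDerivAt (fun y : ℝ => (t, y)) ((0 : ℝ), (1 : ℝ)) x :=
    (hasDerivAt_const x t).prodMk (hasDerivAt_id x)
  exact HasFDerivWithinAt.comp_hasDerivAt x h1 h2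
    (Eventually.of_forall fun y => ⟨ht, mem_univ _⟩)

theorem hasDerivAt_time_fderivWithin (hS : IsOpen S)
    (hf : ContDiffOn ℝ (⊤ : ℕ∞) f (S ×ˢ univ)) {t : ℝ} (ht : t ∈ S) (x : ℝ) :
    HasDerivAt (fun s => f (s, x)) (fderivWithin ℝ f (S ×ˢ univ) (t, x) (1, 0)) t := by
  have h1 : HasFDerivWithinAt f (fderivWithin ℝ f (S ×ˢ univ) (t, x)) (S ×ˢ univ) (t, x) :=
    ((hf.differentiableOn (by simp)) (t, x) ⟨ht, mem_univ _⟩).hasFDerivWithinAt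
  have h2 : HasDerivAt (fun s : ℝ => (s, x)) ((1 : ℝ), (0 : ℝ)) t :=
    (hasDerivAt_id t).prodMk (hasDerivAt_const t x)
  exact HasFDerivWithinAt.comp_hasDerivAt t h1 h2
    (by filter_upwards [hS.mem_nhds ht] with y hy using ⟨hy, mem_univ _⟩)

theorem hasDerivAt_spaceDeriv (hf : ContDiffOn ℝ (⊤ : ℕ∞) f (S ×ˢ univ)) {t : ℝ}
    (ht : t ∈ S) (x : ℝ) : HasDerivAt (fun y => f (t, y)) (spaceDeriv f (t, x)) x :=
  (hasDerivAt_space_fderivWithin hf ht x).differentiableAt.hasDerivAt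

theorem hasDerivAt_timeDeriv (hS : IsOpen S) (hf : ContDiffOn ℝ (⊤ : ℕ∞) f (S ×ˢ univ))
    {t : ℝ} (ht : t ∈ S) (x : ℝ) : HasDerivAt (fun s => f (s, x)) (timeDeriv f (t, x)) t :=
  (hasDerivAt_time_fderivWithin hS hf ht x).differentiableAt.hasDerivAt

theorem contDiffOn_fderivWithin_const_apply (hS : UniqueDiffOn ℝ S)
    (hf : ContDiffOn ℝ (⊤ : ℕ∞) f (S ×ˢ univ)) (v : ℝ × ℝ) :
    ContDiffOn ℝ (⊤ : ℕ∞) (fun p => fderivWithin ℝ f (S ×ˢ univ) p v) (S ×ˢ univ) :=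
  (hf.fderivWithin (hS.prod uniqueDiffOn_univ) (by norm_cast)).clm_apply contDiffOn_const

theorem contDiffOn_spaceDeriv (hS : UniqueDiffOn ℝ S)
    (hf : ContDiffOn ℝ (⊤ : ℕ∞) f (S ×ˢ univ)) :
    ContDiffOn ℝ (⊤ : ℕ∞) (spaceDeriv f) (S ×ˢ univ) :=
  (contDiffOn_fderivWithin_const_apply hS hf (0, 1)).congr fun p hp =>
    (hasDerivAt_space_fderivWithin hf hp.1 p.2).deriv

theorem contDiffOn_timeDeriv (hS : IsOpen S) (hf : ContDiffOn ℝ (⊤ : ℕ∞) f (S ×ˢ univ)) :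
    ContDiffOn ℝ (⊤ : ℕ∞) (timeDeriv f) (S ×ˢ univ) :=
  (contDiffOn_fderivWithin_const_apply hS.uniqueDiffOn hf (1, 0)).congr fun p hp =>
    (hasDerivAt_time_fderivWithin hS hf hp.1 p.2).deriv

theorem timeDeriv_spaceDeriv_comm (hS : IsOpen S) (hf : ContDiffOn ℝ (⊤ : ℕ∞) f (S ×ˢ univ))
    {t : ℝ} (ht : t ∈ S) (x : ℝ) :
    timeDeriv (spaceDeriv f) (t, x) = spaceDeriv (timeDeriv f) (t, x) := by
  have ho : IsOpen (S ×ˢ (univ : Set ℝ)) := hS.prod isOpen_univ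
  have hmem : (t, x) ∈ S ×ˢ (univ : Set ℝ) := ⟨ht, mem_univ _⟩
  have hat : ContDiffAt ℝ (⊤ : ℕ∞) f (t, x) := hf.contDiffAt (ho.mem_nhds hmem)
  have hsymm : IsSymmSndFDerivAt ℝ f (t, x) := hat.isSymmSndFDerivAt <| by
    simpa using WithTop.coe_le_coe.2 (le_top : (2 : ℕ∞) ≤ ⊤)
  have hd : HasFDerivAt (fderiv ℝ f) (fderiv ℝ (fderiv ℝ f) (t, x)) (t, x) :=
    ((hat.fderiv_right (m := 1) (by norm_cast)).differentiableAt (by simp)).hasFDerivAt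
  have hx : HasDerivAt (fun y : ℝ => (t, y)) ((0 : ℝ), (1 : ℝ)) x :=
    (hasDerivAt_const x t).prodMk (hasDerivAt_id x)
  have htt : HasDerivAt (fun s : ℝ => (s, x)) ((1 : ℝ), (0 : ℝ)) t :=
    (hasDerivAt_id t).prodMk (hasDerivAt_const t x)
  have d1 : HasDerivAt (fun s => fderiv ℝ f (s, x)) (fderiv ℝ (fderiv ℝ f) (t, x) (1, 0)) t :=
    HasFDerivAt.comp_hasDerivAt t hd htt
  have d2 : HasDerivAt (fun y => fderiv ℝ f (t, y)) (fderiv ℝ (fderiv ℝ f) (t, x) (0, 1)) x :=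
    HasFDerivAt.comp_hasDerivAt x hd hx
  have e1 : HasDerivAt (fun s => fderiv ℝ f (s, x) (0, 1))
      (fderiv ℝ (fderiv ℝ f) (t, x) (1, 0) (0, 1)) t := by
    simpa using d1.clm_apply (hasDerivAt_const t ((0 : ℝ), (1 : ℝ)))
  have e2 : HasDerivAt (fun y => fderiv ℝ f (t, y) (1, 0))
      (fderiv ℝ (fderiv ℝ f) (t, x) (0, 1) (1, 0)) x := by
    simpa using d2.clm_apply (hasDerivAt_const x ((1 : ℝ), (0 : ℝ)))
  have f1 : timeDeriv (spaceDeriv f) (t, x) = fderiv ℝ (fderiv ℝ f) (t, x) (1, 0) (0, 1) := by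
    refine (e1.congr_of_eventuallyEq ?_).deriv
    filter_upwards [hS.mem_nhds ht] with s hs
    rw [← fderivWithin_of_isOpen ho ⟨hs, mem_univ _⟩]
    exact (hasDerivAt_space_fderivWithin hf hs x).deriv
  have f2 : spaceDeriv (timeDeriv f) (t, x) = fderiv ℝ (fderiv ℝ f) (t, x) (0, 1) (1, 0) := by
    refine (e2.congr_of_eventuallyEq (Eventually.of_forall fun y => ?_)).deriv
    change timeDeriv f (t, y) = fderiv ℝ f (t, y) (1, 0)
    rw [← fderivWithin_of_isOpen ho ⟨ht, mem_univ _⟩]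
    exact (hasDerivAt_time_fderivWithin hS hf ht y).deriv
  rw [f1, f2, hsymm.eq]

theorem continuousOn_slice (hf : ContinuousOn f (S ×ˢ univ)) {t : ℝ} (ht : t ∈ S) :
    Continuous fun x => f (t, x) :=
  hf.comp_continuous (by fun_prop) fun _ => ⟨ht, mem_univ _⟩

theorem continuousOn_integral (hf : ContinuousOn f (S ×ˢ univ)) :
    ContinuousOn (fun t => ∫ x in (0 : ℝ)..1, f (t, x)) S := by
  rw [continuousOn_iff_continuous_domRestrict]
  refine intervalIntegral.continuous_parametric_intervalIntegral_of_continuous'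
    (f := fun (s : S) x => f (s, x)) ?_ 0 1
  exact hf.comp_continuous (by fun_prop) fun p => ⟨p.1.2, mem_univ _⟩

theorem hasDerivAt_integral (hS : IsOpen S) {g : ℝ × ℝ → ℝ} (hf : ContinuousOn f (S ×ˢ univ))
    (hg : ContinuousOn g (S ×ˢ univ))
    (hfg : ∀ t ∈ S, ∀ x, HasDerivAt (fun s => f (s, x)) (g (t, x)) t) {t : ℝ} (ht : t ∈ S) :
    HasDerivAt (fun s => ∫ x in (0 : ℝ)..1, f (s, x)) (∫ x in (0 : ℝ)..1, g (t, x)) t := by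
  obtain ⟨ε, hε, hball⟩ := Metric.nhds_basis_closedBall.mem_iff.1 (hS.mem_nhds ht)
  have hK : IsCompact (Metric.closedBall t ε ×ˢ Icc (0 : ℝ) 1) :=
    (isCompact_closedBall t ε).prod isCompact_Icc
  obtain ⟨B, hB⟩ := hK.exists_bound_of_continuousOn
    (hg.mono (prod_mono hball (subset_univ _)))
  refine (intervalIntegral.hasDerivAt_integral_of_dominated_loc_of_deriv_le
    (F := fun s x => f (s, x)) (F' := fun s x => g (s, x)) (bound := fun _ => B)
    (s := Metric.closedBall t ε) (Metric.closedBall_mem_nhds t hε) ?_ ?_ ?_ ?_ ?_ ?_).2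
  · filter_upwards [hS.mem_nhds ht] with s hs
    exact (continuousOn_slice hf hs).aestronglyMeasurable
  · exact (continuousOn_slice hf ht).intervalIntegrable _ _
  · exact (continuousOn_slice hg ht).aestronglyMeasurable
  · refine Eventually.of_forall fun x hx s hs => hB (s, x) ⟨hs, ?_⟩
    rw [uIoc_of_le zero_le_one] at hx
    exact Ioc_subset_Icc_self hx
  · exact intervalIntegrable_const
  · exact Eventually.of_forall fun x _ s hs => hfg s (hball hs) x

/-- A balance law `∂ₜ e + ∂ₓ q = r` with equal boundary fluxes, integrated over a period. -/
theorem hasDerivAt_integral_of_balance (hS : IsOpen S) {e e' q q' r : ℝ × ℝ → ℝ}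
    (he : ContinuousOn e (S ×ˢ univ)) (he' : ContinuousOn e' (S ×ˢ univ))
    (hr : ContinuousOn r (S ×ˢ univ))
    (hee' : ∀ t ∈ S, ∀ x, HasDerivAt (fun s => e (s, x)) (e' (t, x)) t)
    (hqq' : ∀ t ∈ S, ∀ x, HasDerivAt (fun y => q (t, y)) (q' (t, x)) x)
    (hper : ∀ t ∈ S, q (t, 1) = q (t, 0))
    (hbal : ∀ t ∈ S, ∀ x, e' (t, x) + q' (t, x) = r (t, x)) {t : ℝ} (ht : t ∈ S) :
    HasDerivAt (fun s => ∫ x in (0 : ℝ)..1, e (s, x)) (∫ x in (0 : ℝ)..1, r (t, x)) t := by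
  convert hasDerivAt_integral hS he he' hee' ht using 1
  have hq' : ∀ x, q' (t, x) = r (t, x) - e' (t, x) := fun x => by rw [← hbal t ht x]; ring
  have hrc := continuousOn_slice hr ht
  have hec := continuousOn_slice he' ht
  have h0 : ∫ x in (0 : ℝ)..1, q' (t, x) = 0 := by
    rw [intervalIntegral.integral_eq_sub_of_hasDerivAt (fun x _ => hqq' t ht x), hper t ht, sub_self]
    simp_rw [hq']
    exact (hrc.sub hec).intervalIntegrable _ _
  simp_rw [hq'] at h0
  rw [intervalIntegral.integral_sub (hrc.intervalIntegrable _ _) (hec.intervalIntegrable _ _)] at h0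
  linarith

theorem le_initial_of_hasDerivAt_nonpos {T : ℝ} {f f' : ℝ → ℝ} (hf : ContinuousOn f (Ico 0 T))
    (hf' : ∀ t ∈ Ioo 0 T, HasDerivAt f (f' t) t) (hf'₀ : ∀ t ∈ Ioo 0 T, f' t ≤ 0) {t : ℝ}
    (ht : t ∈ Ico 0 T) : f t ≤ f 0 := by
  refine antitoneOn_of_hasDerivWithinAt_nonpos (f' := f') (convex_Ico 0 T) hf ?_ ?_
    ⟨le_rfl, ht.1.trans_lt ht.2⟩ ht ht.1
  all_goals rw [interior_Ico]
  · exact fun s hs => (hf' s hs).hasDerivWithinAt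
  · exact hf'₀

theorem gronwall_of_hasDerivAt {T L K : ℝ} (hL : 0 < L) {f f' : ℝ → ℝ}
    (hf : ContinuousOn f (Ico 0 T)) (hf' : ∀ t ∈ Ioo 0 T, HasDerivAt f (f' t) t)
    (hle : ∀ t ∈ Ioo 0 T, f' t ≤ L * f t + K) {t : ℝ} (ht : t ∈ Ico 0 T) :
    f t + K / L ≤ Real.exp (L * t) * (f 0 + K / L) := by
  have key : Real.exp (-(L * t)) * (f t + K / L) ≤ Real.exp (-(L * 0)) * (f 0 + K / L) := by
    refine le_initial_of_hasDerivAt_nonpos (f := fun s => Real.exp (-(L * s)) * (f s + K / L))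
      (f' := fun s => Real.exp (-(L * s)) * (f' s - (L * f s + K))) (by fun_prop) ?_ ?_ ht
    · intro s hs
      have h1 : HasDerivAt (fun s => Real.exp (-(L * s))) (Real.exp (-(L * s)) * -(L * 1)) s :=
        ((hasDerivAt_id s).const_mul L).neg.exp
      refine (h1.mul ((hf' s hs).add_const (K / L))).congr_deriv ?_
      field_simp
      ring
    · intro s hs
      exact mul_nonpos_of_nonneg_of_nonpos (Real.exp_nonneg _) (by linarith [hle s hs])
  rw [Real.exp_neg, mul_zero, neg_zero, Real.exp_zero, one_mul, inv_mul_le_iff₀ (Real.exp_pos _)]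
    at key
  exact key

theorem continuousOn_hasDerivAt_primitive {T : ℝ} {g : ℝ → ℝ} (hg : ContinuousOn g (Ico 0 T)) :
    ContinuousOn (fun t => ∫ s in (0 : ℝ)..t, g s) (Ico 0 T) ∧
      ∀ t ∈ Ioo 0 T, HasDerivAt (fun t => ∫ s in (0 : ℝ)..t, g s) (g t) t := by
  have hint : ∀ t ∈ Ico 0 T, IntervalIntegrable g volume 0 t := fun t ht =>
    (hg.mono (by rw [uIcc_of_le ht.1]; exact Icc_subset_Ico_right ht.2)).intervalIntegrable
  constructor
  · intro t ht
    obtain ⟨b, hb⟩ := exists_between ht.2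
    have hb0 : 0 ≤ b := ht.1.trans hb.1.le
    have h1 : ContinuousOn (fun t => ∫ s in (0 : ℝ)..t, g s) (uIcc 0 b) :=
      intervalIntegral.continuousOn_primitive_interval' (hint b ⟨hb0, hb.2⟩) left_mem_uIcc
    rw [uIcc_of_le hb0] at h1
    refine (h1 t ⟨ht.1, hb.1.le⟩).mono_of_mem_nhdsWithin ?_
    filter_upwards [self_mem_nhdsWithin, mem_nhdsWithin_of_mem_nhds (Iio_mem_nhds hb.1)] with s h2 h3
    exact ⟨h2.1, h3.le⟩
  · intro t ht
    have hc := hg.mono (Ioo_subset_Ico_self (a := (0 : ℝ)) (b := T))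
    exact intervalIntegral.integral_hasDerivAt_right (hint t (Ioo_subset_Ico_self ht))
      (hc.stronglyMeasurableAtFilter isOpen_Ioo t ht) (hc.continuousAt (isOpen_Ioo.mem_nhds ht))

end Calculus

/-- A smooth `1`-periodic solution of the non-local Navier–Stokes–Korteweg system on `[0, T)`,
as functions of `(t, x)`, in non-conservative form. -/
structure IsSmoothNSK (μ κ γ T : ℝ) (P : ℝ → ℝ) (ρ u c : ℝ × ℝ → ℝ) : Prop where
  rho : ContDiffOn ℝ (⊤ : ℕ∞) ρ (Ico 0 T ×ˢ univ)
  vel : ContDiffOn ℝ (⊤ : ℕ∞) u (Ico 0 T ×ˢ univ)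
  conc : ContDiffOn ℝ (⊤ : ℕ∞) c (Ico 0 T ×ˢ univ)
  periodic_rho : ∀ t x, ρ (t, x + 1) = ρ (t, x)
  periodic_vel : ∀ t x, u (t, x + 1) = u (t, x)
  periodic_conc : ∀ t x, c (t, x + 1) = c (t, x)
  rho_pos : ∀ p, 0 < ρ p
  mass : ∀ t ∈ Ioo 0 T, ∀ x, timeDeriv ρ (t, x) =
    -(spaceDeriv ρ (t, x) * u (t, x) + ρ (t, x) * spaceDeriv u (t, x))
  momentum : ∀ t ∈ Ioo 0 T, ∀ x,
    ρ (t, x) * (timeDeriv u (t, x) + u (t, x) * spaceDeriv u (t, x)) =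
      -(deriv P (ρ (t, x)) * spaceDeriv ρ (t, x)) + μ * spaceDeriv (spaceDeriv u) (t, x)
        + γ * ρ (t, x) * (spaceDeriv c (t, x) - spaceDeriv ρ (t, x))
  elliptic : ∀ t ∈ Ico 0 T, ∀ x, κ * spaceDeriv (spaceDeriv c) (t, x) = γ * (c (t, x) - ρ (t, x))

/-- A pressure which is continuously differentiable on `(0, ∞)` and has the potential `W`. -/
structure IsPressureWithPotential (P W : ℝ → ℝ) : Prop where
  contP' : ContinuousOn (deriv P) (Ioi 0)
  nonnegW : ∀ r, 0 < r → 0 ≤ W r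
  hasDerivP : ∀ r, 0 < r → HasDerivAt P (deriv P r) r
  hasDerivW : ∀ r, 0 < r → HasDerivAt W (deriv W r) r
  hasDerivW' : ∀ r, 0 < r → HasDerivAt (deriv W) (deriv P r / r) r

/-- The energy density with kinetic part computed from the velocity `w`. -/
noncomputable def energyDensity (κ γ : ℝ) (W : ℝ → ℝ) (ρ c w : ℝ × ℝ → ℝ) (p : ℝ × ℝ) : ℝ :=
  1 / 2 * ρ p * w p ^ 2 + W (ρ p) + γ / 2 * (ρ p - c p) ^ 2 + κ / 2 * spaceDeriv c p ^ 2

/-- The derivative of `φ(ρ)` in space, where `φ' (r) = μ / r ^ 2`. -/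
noncomputable def effectiveDrift (μ : ℝ) (ρ : ℝ × ℝ → ℝ) (p : ℝ × ℝ) : ℝ :=
  μ * spaceDeriv ρ p / ρ p ^ 2

section Periodic

theorem spaceDeriv_periodic {f : ℝ × ℝ → ℝ} (hf : ∀ t x, f (t, x + 1) = f (t, x)) (t x : ℝ) :
    spaceDeriv f (t, x + 1) = spaceDeriv f (t, x) := by
  simp only [spaceDeriv]
  rw [← deriv_comp_add_const (fun y => f (t, y)) 1 x]
  simp_rw [hf]

theorem timeDeriv_periodic {f : ℝ × ℝ → ℝ} (hf : ∀ t x, f (t, x + 1) = f (t, x)) (t x : ℝ) :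
    timeDeriv f (t, x + 1) = timeDeriv f (t, x) := by
  simp only [timeDeriv, hf]

theorem periodic_endpoints {f : ℝ × ℝ → ℝ} (hf : ∀ t x, f (t, x + 1) = f (t, x)) (t : ℝ) :
    f (t, 1) = f (t, 0) := by
  simpa using hf t 0

end Periodic

namespace IsSmoothNSK

variable {μ κ γ T : ℝ} {P W : ℝ → ℝ} {ρ u c w : ℝ × ℝ → ℝ}

theorem continuousOn_energyDensity (h : IsSmoothNSK μ κ γ T P ρ u c)
    (hW : IsPressureWithPotential P W) (hw : ContinuousOn w (Ico 0 T ×ˢ univ)) :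
    ContinuousOn (energyDensity κ γ W ρ c w) (Ico 0 T ×ˢ univ) := by
  have h1 := h.rho.continuousOn
  have h2 := h.conc.continuousOn
  have h3 := (contDiffOn_spaceDeriv (uniqueDiffOn_Ico 0 T) h.conc).continuousOn
  have h4 : ContinuousOn (fun p => W (ρ p)) (Ico 0 T ×ˢ univ) :=
    ContinuousOn.comp (t := Ioi 0)
      (fun r hr => (hW.hasDerivW r hr).continuousAt.continuousWithinAt) h1
      fun p _ => h.rho_pos p
  exact ((ContinuousOn.add (by fun_prop) h4).add (by fun_prop)).add (by fun_prop)

theorem hasDerivAt_integral_energyDensity (h : IsSmoothNSK μ κ γ T P ρ u c)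
    (hW : IsPressureWithPotential P W) (hw : ContDiffOn ℝ (⊤ : ℕ∞) w (Ico 0 T ×ˢ univ))
    (hper : ∀ t x, w (t, x + 1) = w (t, x)) {t : ℝ} (ht : t ∈ Ioo 0 T) :
    HasDerivAt (fun s => ∫ x in (0 : ℝ)..1, energyDensity κ γ W ρ c w (s, x))
      (∫ x in (0 : ℝ)..1,
        (w (t, x) * (ρ (t, x) * (timeDeriv w (t, x) + u (t, x) * spaceDeriv w (t, x)))
          + (deriv P (ρ (t, x)) * spaceDeriv ρ (t, x)
            + γ * ρ (t, x) * (spaceDeriv ρ (t, x) - spaceDeriv c (t, x))) * u (t, x))) t := by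
  have hsub : Ioo 0 T ×ˢ (univ : Set ℝ) ⊆ Ico 0 T ×ˢ univ := prod_mono Ioo_subset_Ico_self le_rfl
  have ho : IsOpen (Ioo 0 T) := isOpen_Ioo
  have hu := ho.uniqueDiffOn (𝕜 := ℝ)
  have hρ := h.rho.mono hsub
  have hv := h.vel.mono hsub
  have hc := h.conc.mono hsub
  have hw' := hw.mono hsub
  have hρx := contDiffOn_spaceDeriv hu hρ
  have hρt := contDiffOn_timeDeriv ho hρ
  have hvx := contDiffOn_spaceDeriv hu hv
  have hcx := contDiffOn_spaceDeriv hu hc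
  have hct := contDiffOn_timeDeriv ho hc
  have hcxx := contDiffOn_spaceDeriv hu hcx
  have hctx := contDiffOn_spaceDeriv hu hct
  have hwx := contDiffOn_spaceDeriv hu hw'
  have hwt := contDiffOn_timeDeriv ho hw'
  have cρ := hρ.continuousOn
  have cv := hv.continuousOn
  have cc := hc.continuousOn
  have cw := hw'.continuousOn
  have cρx := hρx.continuousOn
  have cρt := hρt.continuousOn
  have ccx := hcx.continuousOn
  have cct := hct.continuousOn
  have cctx := hctx.continuousOn
  have cwx := hwx.continuousOn
  have cwt := hwt.continuousOn
  have cW' : ContinuousOn (fun p => deriv W (ρ p)) (Ioo 0 T ×ˢ univ) :=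
    ContinuousOn.comp (t := Ioi 0)
      (fun r hr => (hW.hasDerivW' r hr).continuousAt.continuousWithinAt) cρ
      fun p _ => h.rho_pos p
  have cP' : ContinuousOn (fun p => deriv P (ρ p)) (Ioo 0 T ×ˢ univ) :=
    ContinuousOn.comp (t := Ioi 0) hW.contP' cρ fun p _ => h.rho_pos p
  refine hasDerivAt_integral_of_balance ho (e := energyDensity κ γ W ρ c w)
    (e' := fun p => 1 / 2 * timeDeriv ρ p * w p ^ 2 + ρ p * w p * timeDeriv w p
      + deriv W (ρ p) * timeDeriv ρ p + γ * (ρ p - c p) * (timeDeriv ρ p - timeDeriv c p)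
      + κ * spaceDeriv c p * spaceDeriv (timeDeriv c) p)
    (q := fun p => ρ p * u p * (1 / 2 * w p ^ 2 + deriv W (ρ p) + γ * (ρ p - c p))
      - κ * spaceDeriv c p * timeDeriv c p)
    (q' := fun p => (spaceDeriv ρ p * u p + ρ p * spaceDeriv u p)
        * (1 / 2 * w p ^ 2 + deriv W (ρ p) + γ * (ρ p - c p))
      + ρ p * u p * (w p * spaceDeriv w p + deriv P (ρ p) / ρ p * spaceDeriv ρ p
        + γ * (spaceDeriv ρ p - spaceDeriv c p))
      - (κ * spaceDeriv (spaceDeriv c) p * timeDeriv c p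
        + κ * spaceDeriv c p * spaceDeriv (timeDeriv c) p))
    (r := fun p => w p * (ρ p * (timeDeriv w p + u p * spaceDeriv w p))
      + (deriv P (ρ p) * spaceDeriv ρ p
        + γ * ρ p * (spaceDeriv ρ p - spaceDeriv c p)) * u p)
    ((h.continuousOn_energyDensity hW hw.continuousOn).mono hsub) ?_ ?_ ?_ ?_ ?_ ?_ ht
  · fun_prop
  · fun_prop
  · intro t ht x
    have dρ := hasDerivAt_timeDeriv ho hρ ht x
    have dc := hasDerivAt_timeDeriv ho hc ht x
    have dw := hasDerivAt_timeDeriv ho hw' ht x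
    have dcx := hasDerivAt_timeDeriv ho hcx ht x
    rw [timeDeriv_spaceDeriv_comm ho hc ht x] at dcx
    have dW := (hW.hasDerivW _ (h.rho_pos (t, x))).comp t dρ
    refine HasDerivAt.congr_deriv (((((dρ.const_mul (1 / 2)).mul (dw.pow 2)).add dW).add
      (((dρ.sub dc).pow 2).const_mul (γ / 2))).add ((dcx.pow 2).const_mul (κ / 2))) ?_
    simp
    ring
  · intro t ht x
    have dρ := hasDerivAt_spaceDeriv hρ ht x
    have dv := hasDerivAt_spaceDeriv hv ht x
    have dc := hasDerivAt_spaceDeriv hc ht x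
    have dw := hasDerivAt_spaceDeriv hw' ht x
    have dcx := hasDerivAt_spaceDeriv hcx ht x
    have dct := hasDerivAt_spaceDeriv hct ht x
    have dW := (hW.hasDerivW' _ (h.rho_pos (t, x))).comp x dρ
    refine HasDerivAt.congr_deriv (((dρ.mul dv).mul ((((dw.pow 2).const_mul (1 / 2)).add dW).add
      ((dρ.sub dc).const_mul γ))).sub ((dcx.const_mul κ).mul dct)) ?_
    simp only [Pi.add_apply, Pi.mul_apply, Pi.sub_apply, Pi.pow_apply, Function.comp_apply]
    push_cast
    ring
  · intro t _
    simp only [periodic_endpoints h.periodic_rho, periodic_endpoints h.periodic_vel,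
      periodic_endpoints h.periodic_conc, periodic_endpoints hper,
      periodic_endpoints (spaceDeriv_periodic h.periodic_conc),
      periodic_endpoints (timeDeriv_periodic h.periodic_conc)]
  · intro t ht x
    have hm := h.mass t ht x
    have he := h.elliptic t (Ioo_subset_Ico_self ht) x
    have hne := (h.rho_pos (t, x)).ne'
    simp only [hm, he]
    field_simp
    ring

theorem hasDerivAt_integral_rho (h : IsSmoothNSK μ κ γ T P ρ u c) {t : ℝ} (ht : t ∈ Ioo 0 T) :
    HasDerivAt (fun s => ∫ x in (0 : ℝ)..1, ρ (s, x)) 0 t := by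
  have hsub : Ioo 0 T ×ˢ (univ : Set ℝ) ⊆ Ico 0 T ×ˢ univ := prod_mono Ioo_subset_Ico_self le_rfl
  have ho : IsOpen (Ioo 0 T) := isOpen_Ioo
  have hρ := h.rho.mono hsub
  have hv := h.vel.mono hsub
  simpa using hasDerivAt_integral_of_balance ho (e := ρ) (e' := timeDeriv ρ)
    (q := fun p => ρ p * u p) (q' := fun p => spaceDeriv ρ p * u p + ρ p * spaceDeriv u p)
    (r := fun _ => 0) hρ.continuousOn (contDiffOn_timeDeriv ho hρ).continuousOn
    continuousOn_const (fun t ht x => hasDerivAt_timeDeriv ho hρ ht x)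
    (fun t ht x => (hasDerivAt_spaceDeriv hρ ht x).mul (hasDerivAt_spaceDeriv hv ht x))
    (fun t _ => by simp only [periodic_endpoints h.periodic_rho, periodic_endpoints h.periodic_vel])
    (fun t ht x => by simp only [h.mass t ht x]; ring) ht

theorem integral_rho_le (h : IsSmoothNSK μ κ γ T P ρ u c) {t : ℝ} (ht : t ∈ Ico 0 T) :
    ∫ x in (0 : ℝ)..1, ρ (t, x) ≤ ∫ x in (0 : ℝ)..1, ρ (0, x) :=
  le_initial_of_hasDerivAt_nonpos (f := fun t => ∫ x in (0 : ℝ)..1, ρ (t, x))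
    (continuousOn_integral h.rho.continuousOn)
    (fun _ hs => h.hasDerivAt_integral_rho hs) (fun _ _ => le_rfl) ht

theorem contDiffOn_effectiveDrift (h : IsSmoothNSK μ κ γ T P ρ u c) :
    ContDiffOn ℝ (⊤ : ℕ∞) (effectiveDrift μ ρ) (Ico 0 T ×ˢ univ) :=
  (contDiffOn_const.mul (contDiffOn_spaceDeriv (uniqueDiffOn_Ico 0 T) h.rho)).div (h.rho.pow 2)
    fun p _ => pow_ne_zero 2 (h.rho_pos p).ne'

theorem effectiveDrift_periodic (h : IsSmoothNSK μ κ γ T P ρ u c) (t x : ℝ) :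
    effectiveDrift μ ρ (t, x + 1) = effectiveDrift μ ρ (t, x) := by
  simp only [effectiveDrift, h.periodic_rho, spaceDeriv_periodic h.periodic_rho]

/-- The effective velocity `u + ∂ₓ φ(ρ)` is transported without viscosity. -/
theorem effectiveVelocity_equation (h : IsSmoothNSK μ κ γ T P ρ u c) {t : ℝ} (ht : t ∈ Ioo 0 T)
    (x : ℝ) :
    ρ (t, x) * (timeDeriv (fun p => u p + effectiveDrift μ ρ p) (t, x)
        + u (t, x) * spaceDeriv (fun p => u p + effectiveDrift μ ρ p) (t, x)) =
      -(deriv P (ρ (t, x)) * spaceDeriv ρ (t, x))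
        + γ * ρ (t, x) * (spaceDeriv c (t, x) - spaceDeriv ρ (t, x)) := by
  have hsub : Ioo 0 T ×ˢ (univ : Set ℝ) ⊆ Ico 0 T ×ˢ univ := prod_mono Ioo_subset_Ico_self le_rfl
  have ho : IsOpen (Ioo 0 T) := isOpen_Ioo
  have hu := ho.uniqueDiffOn (𝕜 := ℝ)
  have hρ := h.rho.mono hsub
  have hv := h.vel.mono hsub
  have hρx := contDiffOn_spaceDeriv hu hρ
  have hvx := contDiffOn_spaceDeriv hu hv
  have hne := (h.rho_pos (t, x)).ne'
  have hmom := h.momentum t ht x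
  have hm := h.mass t ht x
  have hmx : timeDeriv (spaceDeriv ρ) (t, x) =
      -(spaceDeriv (spaceDeriv ρ) (t, x) * u (t, x) + spaceDeriv ρ (t, x) * spaceDeriv u (t, x)
        + (spaceDeriv ρ (t, x) * spaceDeriv u (t, x)
          + ρ (t, x) * spaceDeriv (spaceDeriv u) (t, x))) := by
    rw [timeDeriv_spaceDeriv_comm ho hρ ht x]
    have dρ := hasDerivAt_spaceDeriv hρ ht x
    have dv := hasDerivAt_spaceDeriv hv ht x
    have dρx := hasDerivAt_spaceDeriv hρx ht x
    have dvx := hasDerivAt_spaceDeriv hvx ht x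
    refine ((((dρx.mul dv).add (dρ.mul dvx)).neg).congr_of_eventuallyEq ?_).deriv
    exact Eventually.of_forall fun y => h.mass t ht y
  have ht' : timeDeriv (fun p => u p + effectiveDrift μ ρ p) (t, x) = timeDeriv u (t, x)
      + (μ * timeDeriv (spaceDeriv ρ) (t, x) * ρ (t, x) ^ 2
        - μ * spaceDeriv ρ (t, x) * (2 * ρ (t, x) * timeDeriv ρ (t, x))) / (ρ (t, x) ^ 2) ^ 2 := by
    have dρ := hasDerivAt_timeDeriv ho hρ ht x
    refine (HasDerivAt.congr_deriv ((hasDerivAt_timeDeriv ho hv ht x).add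
      (((hasDerivAt_timeDeriv ho hρx ht x).const_mul μ).div (dρ.pow 2)
        (pow_ne_zero 2 hne))) ?_).deriv
    simp
  have hx' : spaceDeriv (fun p => u p + effectiveDrift μ ρ p) (t, x) = spaceDeriv u (t, x)
      + (μ * spaceDeriv (spaceDeriv ρ) (t, x) * ρ (t, x) ^ 2
        - μ * spaceDeriv ρ (t, x) * (2 * ρ (t, x) * spaceDeriv ρ (t, x)))
          / (ρ (t, x) ^ 2) ^ 2 := by
    have dρ := hasDerivAt_spaceDeriv hρ ht x
    refine (HasDerivAt.congr_deriv ((hasDerivAt_spaceDeriv hv ht x).add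
      (((hasDerivAt_spaceDeriv hρx ht x).const_mul μ).div (dρ.pow 2)
        (pow_ne_zero 2 hne))) ?_).deriv
    simp
  rw [ht', hx', hmx, hm]
  field_simp
  linear_combination ρ (t, x) ^ 2 * hmom

theorem integral_energyDensity_vel_le (h : IsSmoothNSK μ κ γ T P ρ u c) (hμ : 0 < μ)
    (hW : IsPressureWithPotential P W) {t : ℝ} (ht : t ∈ Ico 0 T) :
    ∫ x in (0 : ℝ)..1, energyDensity κ γ W ρ c u (t, x)
      ≤ ∫ x in (0 : ℝ)..1, energyDensity κ γ W ρ c u (0, x) := by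
  refine le_initial_of_hasDerivAt_nonpos
    (f := fun t => ∫ x in (0 : ℝ)..1, energyDensity κ γ W ρ c u (t, x))
    (continuousOn_integral (h.continuousOn_energyDensity hW h.vel.continuousOn))
    (fun _ hs => h.hasDerivAt_integral_energyDensity hW h.vel h.periodic_vel hs) ?_ ht
  intro s hs
  have hs' : s ∈ Ico 0 T := Ioo_subset_Ico_self hs
  have hS := uniqueDiffOn_Ico (0 : ℝ) T
  have hux := contDiffOn_spaceDeriv hS h.vel
  have hc1 := continuousOn_slice hux.continuousOn hs'
  have hc0 := continuousOn_slice h.vel.continuousOn hs'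
  have hc2 := continuousOn_slice (contDiffOn_spaceDeriv hS hux).continuousOn hs'
  have hi1 : IntervalIntegrable (fun x => spaceDeriv u (s, x) * spaceDeriv u (s, x)) volume 0 1 :=
    (hc1.mul hc1).intervalIntegrable _ _
  have hi2 : IntervalIntegrable (fun x => u (s, x) * spaceDeriv (spaceDeriv u) (s, x)) volume 0 1 :=
    (hc0.mul hc2).intervalIntegrable _ _
  have hparts : (∫ x in (0 : ℝ)..1, spaceDeriv u (s, x) * spaceDeriv u (s, x))
      + ∫ x in (0 : ℝ)..1, u (s, x) * spaceDeriv (spaceDeriv u) (s, x) = 0 := by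
    rw [← intervalIntegral.integral_add hi1 hi2,
      intervalIntegral.integral_eq_sub_of_hasDerivAt
        (fun x _ => (hasDerivAt_spaceDeriv h.vel hs' x).mul (hasDerivAt_spaceDeriv hux hs' x))
        (hi1.add hi2)]
    simp [periodic_endpoints h.periodic_vel,
      periodic_endpoints (spaceDeriv_periodic h.periodic_vel)]
  have hnonneg : 0 ≤ ∫ x in (0 : ℝ)..1, spaceDeriv u (s, x) * spaceDeriv u (s, x) :=
    intervalIntegral.integral_nonneg zero_le_one fun x _ => mul_self_nonneg _
  have heq : ∀ x, u (s, x) * (ρ (s, x) * (timeDeriv u (s, x) + u (s, x) * spaceDeriv u (s, x)))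
      + (deriv P (ρ (s, x)) * spaceDeriv ρ (s, x)
        + γ * ρ (s, x) * (spaceDeriv ρ (s, x) - spaceDeriv c (s, x))) * u (s, x)
      = μ * (u (s, x) * spaceDeriv (spaceDeriv u) (s, x)) := fun x => by
    rw [h.momentum s hs x]; ring
  simp_rw [heq, intervalIntegral.integral_const_mul]
  nlinarith

theorem abs_spaceDeriv_conc_le (h : IsSmoothNSK μ κ γ T P ρ u c) (hκ : 0 < κ) (hγ : 0 < γ)
    (hW : IsPressureWithPotential P W) (hw : ContinuousOn w (Ico 0 T ×ˢ univ)) {t : ℝ}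
    (ht : t ∈ Ico 0 T) {x : ℝ} (hx : x ∈ Icc (0 : ℝ) 1) :
    |spaceDeriv c (t, x)|
      ≤ γ / κ * (1 / 2 + (∫ y in (0 : ℝ)..1, energyDensity κ γ W ρ c w (t, y)) / γ) := by
  have hS := uniqueDiffOn_Ico (0 : ℝ) T
  have hcx := contDiffOn_spaceDeriv hS h.conc
  have hcc := continuousOn_slice h.conc.continuousOn ht
  have hcρ := continuousOn_slice h.rho.continuousOn ht
  have hce := continuousOn_slice (h.continuousOn_energyDensity hW hw) ht
  obtain ⟨z, hz, hz0⟩ := exists_hasDerivAt_eq_zero (f := fun y => c (t, y)) zero_lt_one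
    hcc.continuousOn (periodic_endpoints h.periodic_conc t).symm
    (fun y _ => hasDerivAt_spaceDeriv h.conc ht y)
  have hcxx : ∀ y, spaceDeriv (spaceDeriv c) (t, y) = γ / κ * (c (t, y) - ρ (t, y)) := fun y => by
    have := h.elliptic t ht y
    field_simp
    linarith
  have hcont : Continuous fun y => γ / κ * (c (t, y) - ρ (t, y)) :=
    continuous_const.mul (hcc.sub hcρ)
  have hftc : ∫ y in z..x, γ / κ * (c (t, y) - ρ (t, y)) = spaceDeriv c (t, x) := by
    rw [intervalIntegral.integral_eq_sub_of_hasDerivAt (f := fun y => spaceDeriv c (t, y))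
      (fun y _ => by simpa only [hcxx] using hasDerivAt_spaceDeriv hcx ht y)
      (hcont.intervalIntegrable _ _), hz0, sub_zero]
  have hpt : ∀ y, |γ / κ * (c (t, y) - ρ (t, y))|
      ≤ γ / κ * (1 / 2 + energyDensity κ γ W ρ c w (t, y) / γ) := fun y => by
    rw [abs_mul, abs_of_pos (div_pos hγ hκ)]
    refine mul_le_mul_of_nonneg_left ?_ (div_pos hγ hκ).le
    have hW0 := hW.nonnegW _ (h.rho_pos (t, y))
    have h1 : 0 ≤ 1 / 2 * ρ (t, y) * w (t, y) ^ 2 :=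
      mul_nonneg (mul_nonneg (by norm_num) (h.rho_pos _).le) (sq_nonneg _)
    have h2 : 0 ≤ κ / 2 * spaceDeriv c (t, y) ^ 2 := by positivity
    have h3 : (ρ (t, y) - c (t, y)) ^ 2 / 2 ≤ energyDensity κ γ W ρ c w (t, y) / γ := by
      rw [le_div_iff₀ hγ]
      unfold energyDensity
      linarith
    have h4 : |c (t, y) - ρ (t, y)| ≤ 1 / 2 + (ρ (t, y) - c (t, y)) ^ 2 / 2 := by
      rw [abs_le]
      constructor <;> nlinarith [sq_nonneg (c (t, y) - ρ (t, y) - 1),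
        sq_nonneg (c (t, y) - ρ (t, y) + 1)]
    linarith
  rw [← hftc]
  have hsub : uIoc z x ⊆ Ioc 0 1 :=
    Ioc_subset_Ioc (le_min hz.1.le hx.1) (max_le hz.2.le hx.2)
  have hcabs : Continuous fun y => ‖γ / κ * (c (t, y) - ρ (t, y))‖ := hcont.norm
  have hi : IntervalIntegrable (fun y => γ / κ * (1 / 2 + energyDensity κ γ W ρ c w (t, y) / γ))
      volume 0 1 := Continuous.intervalIntegrable (by fun_prop) _ _
  calc |∫ y in z..x, γ / κ * (c (t, y) - ρ (t, y))|
      ≤ ∫ y in uIoc z x, ‖γ / κ * (c (t, y) - ρ (t, y))‖ := by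
        rw [← Real.norm_eq_abs]
        exact intervalIntegral.norm_integral_le_integral_norm_uIoc
    _ ≤ ∫ y in Ioc (0 : ℝ) 1, ‖γ / κ * (c (t, y) - ρ (t, y))‖ :=
        setIntegral_mono_set (hcabs.integrableOn_Ioc)
          (Eventually.of_forall fun _ => norm_nonneg _) hsub.eventuallyLE
    _ = ∫ y in (0 : ℝ)..1, ‖γ / κ * (c (t, y) - ρ (t, y))‖ := by
        rw [intervalIntegral.integral_of_le zero_le_one]
    _ ≤ ∫ y in (0 : ℝ)..1, γ / κ * (1 / 2 + energyDensity κ γ W ρ c w (t, y) / γ) :=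
        intervalIntegral.integral_mono_on zero_le_one (hcabs.intervalIntegrable _ _) hi
          fun y _ => hpt y
    _ = γ / κ * (1 / 2 + (∫ y in (0 : ℝ)..1, energyDensity κ γ W ρ c w (t, y)) / γ) := by
        rw [intervalIntegral.integral_const_mul, intervalIntegral.integral_add
          intervalIntegrable_const ((hce.div_const γ).intervalIntegrable _ _),
          intervalIntegral.integral_div]
        simp

theorem rho_mul_effectiveDrift_sq_le (h : IsSmoothNSK μ κ γ T P ρ u c) (hκ : 0 < κ) (hγ : 0 < γ)
    (hW : IsPressureWithPotential P W) (p : ℝ × ℝ) :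
    ρ p * effectiveDrift μ ρ p ^ 2
      ≤ 4 * energyDensity κ γ W ρ c (fun p => u p + effectiveDrift μ ρ p) p
        + 4 * energyDensity κ γ W ρ c u p := by
  have hW0 := hW.nonnegW _ (h.rho_pos p)
  have h1 : 0 ≤ ρ p * (2 * u p + effectiveDrift μ ρ p) ^ 2 :=
    mul_nonneg (h.rho_pos p).le (sq_nonneg _)
  have h2 : 0 ≤ κ / 2 * spaceDeriv c p ^ 2 := by positivity
  have h3 : 0 ≤ γ / 2 * (ρ p - c p) ^ 2 := by positivity
  unfold energyDensity
  linarith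

theorem drift_coupling_le (h : IsSmoothNSK μ κ γ T P ρ u c) (hκ : 0 < κ) (hγ : 0 < γ)
    (hW : IsPressureWithPotential P W) {B : ℝ} {p : ℝ × ℝ} (hB : |spaceDeriv c p| ≤ B) :
    γ * ρ p * effectiveDrift μ ρ p * spaceDeriv c p
      ≤ 2 * γ * energyDensity κ γ W ρ c (fun p => u p + effectiveDrift μ ρ p) p
        + 2 * γ * energyDensity κ γ W ρ c u p + γ / 2 * B ^ 2 * ρ p := by
  have h1 := h.rho_mul_effectiveDrift_sq_le hκ hγ hW p
  have h2 : spaceDeriv c p ^ 2 ≤ B ^ 2 := sq_le_sq' (abs_le.1 hB).1 (abs_le.1 hB).2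
  have hρ := h.rho_pos p
  have h3 := mul_le_mul_of_nonneg_left h1 (half_pos hγ).le
  have h4 := mul_le_mul_of_nonneg_left h2 (mul_pos (half_pos hγ) hρ).le
  have h5 : 0 ≤ γ / 2 * ρ p * (effectiveDrift μ ρ p - spaceDeriv c p) ^ 2 := by positivity
  linarith

theorem continuousOn_dissipation (h : IsSmoothNSK μ κ γ T P ρ u c)
    (hW : IsPressureWithPotential P W) :
    ContinuousOn (fun p => effectiveDrift μ ρ p * ((deriv P (ρ p) + γ * ρ p) * spaceDeriv ρ p))
      (Ico 0 T ×ˢ univ) := by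
  have hρ := h.rho.continuousOn
  have hρx := (contDiffOn_spaceDeriv (uniqueDiffOn_Ico 0 T) h.rho).continuousOn
  have hψ := h.contDiffOn_effectiveDrift.continuousOn
  have hP' : ContinuousOn (fun p => deriv P (ρ p)) (Ico 0 T ×ˢ univ) :=
    ContinuousOn.comp (t := Ioi 0) hW.contP' hρ fun p _ => h.rho_pos p
  fun_prop

/-- The exponential bound on the effective energy, given bounds on the initial data. -/
theorem effective_energy_le (h : IsSmoothNSK μ κ γ T P ρ u c) (hμ : 0 < μ) (hκ : 0 < κ)
    (hγ : 0 < γ) (hW : IsPressureWithPotential P W) (hmono : ∀ r, 0 < r → 0 ≤ deriv P r + γ * r)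
    {A M : ℝ} (hA : 0 ≤ A) (hM : 0 ≤ M)
    (hu0 : ∫ x in (0 : ℝ)..1, energyDensity κ γ W ρ c u (0, x) ≤ A)
    (hv0 : ∫ x in (0 : ℝ)..1,
      energyDensity κ γ W ρ c (fun p => u p + effectiveDrift μ ρ p) (0, x) ≤ A)
    (hρ0 : ∫ x in (0 : ℝ)..1, ρ (0, x) ≤ M) {t : ℝ} (ht : t ∈ Ico 0 T) :
    (∫ x in (0 : ℝ)..1, energyDensity κ γ W ρ c (fun p => u p + effectiveDrift μ ρ p) (t, x))
      + (∫ s in (0 : ℝ)..t, ∫ x in (0 : ℝ)..1, effectiveDrift μ ρ (s, x) *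
          ((deriv P (ρ (s, x)) + γ * ρ (s, x)) * spaceDeriv ρ (s, x)))
      ≤ Real.exp (2 * γ * T) *
        (A + (2 * γ * A + γ / 2 * (γ / κ * (1 / 2 + A / γ)) ^ 2 * M) / (2 * γ)) ∧
    0 ≤ ∫ s in (0 : ℝ)..t, ∫ x in (0 : ℝ)..1, effectiveDrift μ ρ (s, x) *
          ((deriv P (ρ (s, x)) + γ * ρ (s, x)) * spaceDeriv ρ (s, x)) := by
  set B := γ / κ * (1 / 2 + A / γ) with hB
  set v : ℝ × ℝ → ℝ := fun p => u p + effectiveDrift μ ρ p with hv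
  set d : ℝ × ℝ → ℝ := fun p => effectiveDrift μ ρ p *
    ((deriv P (ρ p) + γ * ρ p) * spaceDeriv ρ p) with hd
  have hvs : ContDiffOn ℝ (⊤ : ℕ∞) v (Ico 0 T ×ˢ univ) := h.vel.add h.contDiffOn_effectiveDrift
  have hvper : ∀ t x, v (t, x + 1) = v (t, x) := fun t x => by
    simp only [hv, h.periodic_vel, h.effectiveDrift_periodic]
  have hdc : ContinuousOn d (Ico 0 T ×ˢ univ) := h.continuousOn_dissipation hW
  have hd0 : ∀ p, 0 ≤ d p := fun p => by
    have h1 := hmono _ (h.rho_pos p)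
    have h2 : d p = μ * (deriv P (ρ p) + γ * ρ p) * spaceDeriv ρ p ^ 2 / ρ p ^ 2 := by
      simp only [hd, effectiveDrift]; ring
    rw [h2]
    positivity
  have hev := h.continuousOn_energyDensity hW hvs.continuousOn
  have heu := h.continuousOn_energyDensity hW h.vel.continuousOn
  obtain ⟨hpc, hpd⟩ := continuousOn_hasDerivAt_primitive (continuousOn_integral hdc)
  have hdint : ∀ s ∈ Ico 0 T, 0 ≤ ∫ r in (0 : ℝ)..s, ∫ x in (0 : ℝ)..1, d (r, x) := fun s hs =>
    intervalIntegral.integral_nonneg hs.1 fun r _ =>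
      intervalIntegral.integral_nonneg zero_le_one fun x _ => hd0 _
  have hψc := h.contDiffOn_effectiveDrift.continuousOn
  have hρc := h.rho.continuousOn
  have hcxc := (contDiffOn_spaceDeriv (uniqueDiffOn_Ico 0 T) h.conc).continuousOn
  have hbound := gronwall_of_hasDerivAt (L := 2 * γ) (K := 2 * γ * A + γ / 2 * B ^ 2 * M)
    (by positivity)
    (f := fun s => (∫ x in (0 : ℝ)..1, energyDensity κ γ W ρ c v (s, x))
      + ∫ r in (0 : ℝ)..s, ∫ x in (0 : ℝ)..1, d (r, x))
    ((continuousOn_integral hev).add hpc)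
    (fun s hs => (h.hasDerivAt_integral_energyDensity hW hvs hvper hs).add (hpd s hs)) ?_ ht
  · refine ⟨?_, hdint t ht⟩
    have hK : 0 ≤ (2 * γ * A + γ / 2 * B ^ 2 * M) / (2 * γ) := by positivity
    have hexp : Real.exp (2 * γ * t) ≤ Real.exp (2 * γ * T) :=
      Real.exp_le_exp.2 (mul_le_mul_of_nonneg_left ht.2.le (by positivity))
    simp only [intervalIntegral.integral_same, add_zero] at hbound
    calc _ ≤ Real.exp (2 * γ * t) * ((∫ x in (0 : ℝ)..1, energyDensity κ γ W ρ c v (0, x))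
            + (2 * γ * A + γ / 2 * B ^ 2 * M) / (2 * γ)) := by linarith
      _ ≤ Real.exp (2 * γ * t) * (A + (2 * γ * A + γ / 2 * B ^ 2 * M) / (2 * γ)) := by gcongr
      _ ≤ _ := by gcongr
  · intro s hs
    have hs' : s ∈ Ico 0 T := Ioo_subset_Ico_self hs
    have hEu := (h.integral_energyDensity_vel_le hμ hW hs').trans hu0
    have hmass := (h.integral_rho_le hs').trans hρ0
    have hev' := continuousOn_slice hev hs'
    have heu' := continuousOn_slice heu hs'
    have hρ' := continuousOn_slice hρc hs'
    have hψ' := continuousOn_slice hψc hs'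
    have hcx' := continuousOn_slice hcxc hs'
    have hd' := continuousOn_slice hdc hs'
    have hBx : ∀ x ∈ Icc (0 : ℝ) 1, |spaceDeriv c (s, x)| ≤ B := fun x hx =>
      (h.abs_spaceDeriv_conc_le hκ hγ hW h.vel.continuousOn hs' hx).trans (by rw [hB]; gcongr)
    have hrate : ∀ x, v (s, x) * (ρ (s, x) * (timeDeriv v (s, x) + u (s, x) * spaceDeriv v (s, x)))
        + (deriv P (ρ (s, x)) * spaceDeriv ρ (s, x)
          + γ * ρ (s, x) * (spaceDeriv ρ (s, x) - spaceDeriv c (s, x))) * u (s, x)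
        = γ * ρ (s, x) * effectiveDrift μ ρ (s, x) * spaceDeriv c (s, x) - d (s, x) := fun x => by
      rw [h.effectiveVelocity_equation hs x]
      simp only [hv, hd]
      ring
    simp_rw [hrate]
    have hi1 : Continuous fun x =>
        γ * ρ (s, x) * effectiveDrift μ ρ (s, x) * spaceDeriv c (s, x) :=
      ((continuous_const.mul hρ').mul hψ').mul hcx'
    rw [intervalIntegral.integral_sub (hi1.intervalIntegrable _ _) (hd'.intervalIntegrable _ _),
      sub_add_cancel]
    have hi2 := hev'.const_mul (2 * γ)
    have hi3 := heu'.const_mul (2 * γ)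
    have hi23 : Continuous fun x => 2 * γ * energyDensity κ γ W ρ c v (s, x)
        + 2 * γ * energyDensity κ γ W ρ c u (s, x) := hi2.add hi3
    have hi4 := hρ'.const_mul (γ / 2 * B ^ 2)
    calc _ ≤ ∫ x in (0 : ℝ)..1, (2 * γ * energyDensity κ γ W ρ c v (s, x)
          + 2 * γ * energyDensity κ γ W ρ c u (s, x) + γ / 2 * B ^ 2 * ρ (s, x)) :=
          intervalIntegral.integral_mono_on zero_le_one (hi1.intervalIntegrable _ _)
            ((hi23.add hi4).intervalIntegrable _ _)
            fun x hx => h.drift_coupling_le hκ hγ hW (hBx x hx)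
      _ = 2 * γ * (∫ x in (0 : ℝ)..1, energyDensity κ γ W ρ c v (s, x))
          + 2 * γ * (∫ x in (0 : ℝ)..1, energyDensity κ γ W ρ c u (s, x))
          + γ / 2 * B ^ 2 * ∫ x in (0 : ℝ)..1, ρ (s, x) := by
          rw [intervalIntegral.integral_add (hi23.intervalIntegrable _ _)
            (hi4.intervalIntegrable _ _), intervalIntegral.integral_add
            (hi2.intervalIntegrable _ _) (hi3.intervalIntegrable _ _)]
          simp only [intervalIntegral.integral_const_mul]
      _ ≤ 2 * γ * (∫ x in (0 : ℝ)..1, energyDensity κ γ W ρ c v (s, x))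
          + 2 * γ * A + γ / 2 * B ^ 2 * M := by gcongr
      _ ≤ _ := by nlinarith [hdint s hs']

/-- Bound of the initial energy through the elliptic equation for `c`. -/
theorem integral_energyDensity_zero_le (h : IsSmoothNSK μ κ γ T P ρ u c) (hT : 0 < T)
    (hκ : 0 < κ) (hγ : 0 < γ) (hW : IsPressureWithPotential P W)
    (hw : ContinuousOn w (Ico 0 T ×ˢ univ)) {M N Hρ Hu : ℝ} (hM : 0 < M)
    (hρM : ∀ x, M⁻¹ ≤ ρ (0, x) ∧ ρ (0, x) ≤ M) (hWN : ∀ r ∈ Icc M⁻¹ M, W r ≤ N)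
    (hw0 : ∀ x, w (0, x) ^ 2 ≤ 2 * (u (0, x) ^ 2 + effectiveDrift μ ρ (0, x) ^ 2))
    (hHρ : ∫ x in (0 : ℝ)..1, (ρ (0, x) ^ 2 + spaceDeriv ρ (0, x) ^ 2) = Hρ)
    (hHu : ∫ x in (0 : ℝ)..1, (u (0, x) ^ 2 + spaceDeriv u (0, x) ^ 2) = Hu) :
    ∫ x in (0 : ℝ)..1, energyDensity κ γ W ρ c w (0, x)
      ≤ M * Hu + μ ^ 2 * M ^ 5 * Hρ + (N + γ / 2 * M ^ 2) := by
  have h0 : (0 : ℝ) ∈ Ico 0 T := ⟨le_rfl, hT⟩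
  have hS := uniqueDiffOn_Ico (0 : ℝ) T
  have hcx := contDiffOn_spaceDeriv hS h.conc
  have hce := continuousOn_slice (h.continuousOn_energyDensity hW hw) h0
  have hcρ := continuousOn_slice h.rho.continuousOn h0
  have hcu := continuousOn_slice h.vel.continuousOn h0
  have hcc := continuousOn_slice h.conc.continuousOn h0
  have hcρx := continuousOn_slice (contDiffOn_spaceDeriv hS h.rho).continuousOn h0
  have hcux := continuousOn_slice (contDiffOn_spaceDeriv hS h.vel).continuousOn h0
  have hccx := continuousOn_slice hcx.continuousOn h0
  have hccxx := continuousOn_slice (contDiffOn_spaceDeriv hS hcx).continuousOn h0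
  set g : ℝ → ℝ := fun x => spaceDeriv c (0, x) * spaceDeriv c (0, x)
    + c (0, x) * spaceDeriv (spaceDeriv c) (0, x) with hg
  have hgi : IntervalIntegrable g volume 0 1 :=
    ((hccx.mul hccx).add (hcc.mul hccxx)).intervalIntegrable _ _
  have hg0 : ∫ x in (0 : ℝ)..1, g x = 0 := by
    rw [intervalIntegral.integral_eq_sub_of_hasDerivAt
      (fun x _ => (hasDerivAt_spaceDeriv h.conc h0 x).mul (hasDerivAt_spaceDeriv hcx h0 x)) hgi]
    simp [periodic_endpoints h.periodic_conc,
      periodic_endpoints (spaceDeriv_periodic h.periodic_conc)]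
  have hiu : IntervalIntegrable (fun x => M * (u (0, x) ^ 2 + spaceDeriv u (0, x) ^ 2))
    volume 0 1 := (((hcu.pow 2).add (hcux.pow 2)).const_mul M).intervalIntegrable _ _
  have hiρ : IntervalIntegrable
      (fun x => μ ^ 2 * M ^ 5 * (ρ (0, x) ^ 2 + spaceDeriv ρ (0, x) ^ 2)) volume 0 1 :=
    (((hcρ.pow 2).add (hcρx.pow 2)).const_mul _).intervalIntegrable _ _
  have hpt : ∀ x, energyDensity κ γ W ρ c w (0, x) ≤
      M * (u (0, x) ^ 2 + spaceDeriv u (0, x) ^ 2)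
        + μ ^ 2 * M ^ 5 * (ρ (0, x) ^ 2 + spaceDeriv ρ (0, x) ^ 2)
        + (N + γ / 2 * M ^ 2) + κ * g x := fun x => by
    have hpos := h.rho_pos (0, x)
    obtain ⟨hl, hr⟩ := hρM x
    have e1 := hWN _ ⟨hl, hr⟩
    have e2 : γ / 2 * ρ (0, x) ^ 2 ≤ γ / 2 * M ^ 2 := by gcongr
    have e3 := h.elliptic 0 h0 x
    have e4 : 1 / ρ (0, x) ^ 4 ≤ M ^ 4 := by
      rw [one_div, ← inv_pow]
      gcongr
      exact inv_le_of_inv_le₀ hM hl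
    have e5 : effectiveDrift μ ρ (0, x) ^ 2 ≤ μ ^ 2 * spaceDeriv ρ (0, x) ^ 2 * M ^ 4 := by
      calc _ = μ ^ 2 * spaceDeriv ρ (0, x) ^ 2 * (1 / ρ (0, x) ^ 4) := by
            simp only [effectiveDrift]; field_simp
        _ ≤ _ := by gcongr
    have e6 : 1 / 2 * ρ (0, x) * w (0, x) ^ 2
        ≤ 1 / 2 * M * (2 * (u (0, x) ^ 2 + μ ^ 2 * spaceDeriv ρ (0, x) ^ 2 * M ^ 4)) := by
      have := hw0 x
      gcongr
      linarith
    have e7 : 0 ≤ M * spaceDeriv u (0, x) ^ 2 := by positivity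
    have e8 : 0 ≤ μ ^ 2 * M ^ 5 * ρ (0, x) ^ 2 := by positivity
    have e9 : 0 ≤ κ / 2 * spaceDeriv c (0, x) ^ 2 := by positivity
    have e10 : 0 ≤ γ / 2 * c (0, x) ^ 2 := by positivity
    have e11 : κ * g x = κ * spaceDeriv c (0, x) ^ 2
        + c (0, x) * (γ * (c (0, x) - ρ (0, x))) := by
      rw [← e3]; simp only [hg]; ring
    rw [e11]
    unfold energyDensity
    linarith
  have hi := intervalIntegral.integral_mono_on zero_le_one (hce.intervalIntegrable 0 1)
    (((hiu.add hiρ).add (intervalIntegrable_const (c := N + γ / 2 * M ^ 2))).add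
      (hgi.const_mul κ)) fun x _ => hpt x
  rw [intervalIntegral.integral_add ((hiu.add hiρ).add intervalIntegrable_const) (hgi.const_mul κ),
    intervalIntegral.integral_add (hiu.add hiρ) intervalIntegrable_const,
    intervalIntegral.integral_add hiu hiρ, intervalIntegral.integral_const_mul,
    intervalIntegral.integral_const_mul, intervalIntegral.integral_const_mul, hHρ, hHu, hg0] at hi
  simpa using hi

end IsSmoothNSK

theorem isPressureWithPotential {P W : ℝ → ℝ} {γ β a : ℝ} (hP : IsAdmissiblePair P γ β a)
    (hW : IsPressurePotential P W) : IsPressureWithPotential P W := by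
  have hP1 : ContDiffOn ℝ 1 P (Ioi 0) := hP.smooth.mono Ioi_subset_Ici_self
  have hW1 : ContDiffOn ℝ 1 (deriv W) (Ioi 0) :=
    ((contDiffOn_succ_iff_deriv_of_isOpen (n := 1) isOpen_Ioi).1
      (by simpa [one_add_one_eq_two] using hW.smooth)).2.2
  refine ⟨hP1.continuousOn_deriv_of_isOpen isOpen_Ioi le_rfl, fun r hr => hW.nonneg r hr.le,
    fun r hr => ?_, fun r hr => ?_, fun r hr => ?_⟩
  · exact ((hP1.differentiableOn (by simp)).differentiableAt (Ioi_mem_nhds hr)).hasDerivAt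
  · exact ((hW.smooth.differentiableOn (by simp)).differentiableAt (Ioi_mem_nhds hr)).hasDerivAt
  · rw [← hW.relation r hr, mul_div_cancel_right₀ _ hr.ne']
    exact ((hW1.differentiableOn (by simp)).differentiableAt (Ioi_mem_nhds hr)).hasDerivAt

theorem hasDerivAt_artificialPressure {P W : ℝ → ℝ} (γ : ℝ) (hW : IsPressureWithPotential P W)
    {r : ℝ} (hr : 0 < r) : HasDerivAt (artificialPressure P γ) (deriv P r + γ * r) r := by
  refine ((hW.hasDerivP r hr).add ((hasDerivAt_pow 2 r).const_mul (γ / 2))).congr_deriv ?_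
  push_cast
  ring

theorem deriv_artificialPressure_nonneg {P W : ℝ → ℝ} {γ β a : ℝ} (hP : IsAdmissiblePair P γ β a)
    (hW : IsPressureWithPotential P W) {r : ℝ} (hr : 0 < r) : 0 ≤ deriv P r + γ * r := by
  rw [← (hasDerivAt_artificialPressure γ hW hr).hasDerivWithinAt.derivWithin
    (isOpen_Ioi.uniqueDiffWithinAt (s := Ioi 0) hr)]
  exact (hP.mono.mono Ioi_subset_Ici_self).derivWithin_nonneg

theorem IsNSKSolution.isSmoothNSK {μ κ γ T : ℝ} {P W : ℝ → ℝ} {ρ u c : ℝ → ℝ → ℝ} {ρ₀ u₀ : ℝ → ℝ}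
    (h : IsNSKSolution μ κ γ P (Ico 0 T) ρ u c ρ₀ u₀) (hW : IsPressureWithPotential P W) :
    IsSmoothNSK μ κ γ T P (fun p => ρ p.1 p.2) (fun p => u p.1 p.2) (fun p => c p.1 p.2) := by
  have hsub : Ioo 0 T ×ˢ (univ : Set ℝ) ⊆ Ico 0 T ×ˢ univ := prod_mono Ioo_subset_Ico_self le_rfl
  have ho : IsOpen (Ioo 0 T) := isOpen_Ioo
  have hmass : ∀ t ∈ Ioo 0 T, ∀ x, timeDeriv (fun p => ρ p.1 p.2) (t, x) =
      -(spaceDeriv (fun p => ρ p.1 p.2) (t, x) * u t x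
        + ρ t x * spaceDeriv (fun p => u p.1 p.2) (t, x)) := fun t ht x => by
    have ht' : t ∈ Ico 0 T := Ioo_subset_Ico_self ht
    have hm := h.mass t ht' x
    have e : deriv (fun y => ρ t y * u t y) x = spaceDeriv (fun p => ρ p.1 p.2) (t, x) * u t x
        + ρ t x * spaceDeriv (fun p => u p.1 p.2) (t, x) :=
      ((hasDerivAt_spaceDeriv h.smooth_rho ht' x).mul
        (hasDerivAt_spaceDeriv h.smooth_u ht' x)).deriv
    rw [e] at hm
    exact eq_neg_of_add_eq_zero_left hm
  refine ⟨h.smooth_rho, h.smooth_u, h.smooth_c, h.periodic_rho, h.periodic_u, h.periodic_c,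
    fun p => h.rho_pos p.1 p.2, hmass, fun t ht x => ?_, fun t ht x => ?_⟩
  · have ht' : t ∈ Ico 0 T := Ioo_subset_Ico_self ht
    have dρ := hasDerivAt_spaceDeriv h.smooth_rho ht' x
    have du := hasDerivAt_spaceDeriv h.smooth_u ht' x
    have dc := hasDerivAt_spaceDeriv h.smooth_c ht' x
    have dP := (hW.hasDerivP _ (h.rho_pos t x)).comp x dρ
    have dρt := hasDerivAt_timeDeriv ho (h.smooth_rho.mono hsub) ht x
    have dut := hasDerivAt_timeDeriv ho (h.smooth_u.mono hsub) ht x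
    have e1 := (dρt.mul dut).deriv
    have e2 := (dρ.mul (du.pow 2)).deriv
    have e3 := dP.deriv
    have e4 := (dc.sub dρ).deriv
    have e5 : deriv (deriv (u t)) x = spaceDeriv (spaceDeriv fun p => u p.1 p.2) (t, x) := rfl
    have hm := h.momentum t ht' x
    have hms := hmass t ht x
    simp only [Pi.pow_apply] at e2
    push_cast at e2
    erw [e1, e2, e3, e4, e5, hms] at hm
    linear_combination hm
  · have he := h.elliptic t ht x
    have e5 : deriv (deriv (c t)) x = spaceDeriv (spaceDeriv fun p => c p.1 p.2) (t, x) := rfl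
    rw [e5] at he
    linear_combination -he

theorem hasDerivAt_integral_div_sq (μ : ℝ) {r : ℝ} (hr : 0 < r) :
    HasDerivAt (fun r => ∫ s in (1 : ℝ)..r, μ / s ^ 2) (μ / r ^ 2) r := by
  have hc : ContinuousOn (fun s : ℝ => μ / s ^ 2) (Ioi 0) :=
    continuousOn_const.div (by fun_prop) fun s hs => pow_ne_zero 2 (ne_of_gt hs)
  refine intervalIntegral.integral_hasDerivAt_right ?_
    (hc.stronglyMeasurableAtFilter isOpen_Ioi r hr) (hc.continuousAt (Ioi_mem_nhds hr))
  refine (hc.mono fun s hs => ?_).intervalIntegrable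
  exact (lt_min one_pos hr).trans_le hs.1

theorem deriv_inv_sqrt_sq {f : ℝ → ℝ} {f' x : ℝ} (hf : HasDerivAt f f' x) (hpos : 0 < f x) :
    deriv (fun y => (Real.sqrt (f y))⁻¹) x ^ 2 = f' ^ 2 / (4 * f x ^ 3) := by
  have hs : 0 < Real.sqrt (f x) := Real.sqrt_pos.2 hpos
  have e : Real.sqrt (f x) ^ 2 = f x := Real.sq_sqrt hpos.le
  have h1 : deriv (fun y => (Real.sqrt (f y))⁻¹) x
      = -(f' / (2 * Real.sqrt (f x))) / Real.sqrt (f x) ^ 2 :=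
    ((hf.sqrt hpos.ne').inv hs.ne').deriv
  have e3 : (2 * Real.sqrt (f x)) ^ 2 = 4 * f x := by rw [mul_pow, e]; norm_num
  rw [h1, e, div_pow, neg_sq, div_pow, e3]
  field_simp

theorem H1norm_sq (f : ℝ → ℝ) : H1norm f ^ 2 = ∫ x in (0 : ℝ)..1, (f x ^ 2 + deriv f x ^ 2) :=
  Real.sq_sqrt (intervalIntegral.integral_nonneg zero_le_one fun x _ => by positivity)

/-- A bound on the initial energy in terms of the norms of the initial data. -/
noncomputable def initialEnergyBound (Hρ Hu M μ γ : ℝ) (W : ℝ → ℝ) : ℝ :=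
  M * Hu ^ 2 + μ ^ 2 * M ^ 5 * Hρ ^ 2 + (sSup (W '' Icc M⁻¹ M) + γ / 2 * M ^ 2)

/-- The exponential bound on the effective energy in terms of the initial energy bound `A`. -/
noncomputable def effectiveEnergyBound (A M κ γ T : ℝ) : ℝ :=
  Real.exp (2 * γ * T) * (A + (2 * γ * A + γ / 2 * (γ / κ * (1 / 2 + A / γ)) ^ 2 * M) / (2 * γ))

/-- Bresch–Desjardin entropy inequality: there is a constant `C(T₀) > 0`, depending
only on `‖ρ₀‖_{H¹}`, `‖u₀‖_{H¹}`, `M₀`, `μ`, `κ`, `γ`, `W` and `T₀`, bounding the BD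
entropy (with `φ(r) = ∫₁^r μ/s² ds`) and, in particular, `‖∂ₓ(ρ^{-1/2})‖_{L²}`. -/
theorem BD_entropy_inequality :
    ∃ C : ℝ → ℝ → ℝ → ℝ → ℝ → ℝ → (ℝ → ℝ) → ℝ → ℝ,
      ∀ (μ κ γ M₀ T₀ β a : ℝ) (P W : ℝ → ℝ) (ρ u c : ℝ → ℝ → ℝ) (ρ₀ u₀ : ℝ → ℝ),
        0 < μ → 0 < κ → 0 < γ → 0 < M₀ → 0 < T₀ →
        IsAdmissiblePair P γ β a → IsPressurePotential P W →
        IsNSKSolution μ κ γ P (Set.Ico 0 T₀) ρ u c ρ₀ u₀ →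
        (∀ x : ℝ, M₀⁻¹ ≤ ρ₀ x ∧ ρ₀ x ≤ M₀) →
        0 < C (H1norm ρ₀) (H1norm u₀) M₀ μ κ γ W T₀ ∧
        (∀ t ∈ Set.Ico 0 T₀,
          (∫ x in (0:ℝ)..1,
              (1 / 2 * ρ t x
                  * (u t x + deriv (fun y => ∫ s in (1:ℝ)..(ρ t y), μ / s ^ 2) x) ^ 2
                + W (ρ t x) + γ / 2 * (ρ t x - c t x) ^ 2 + κ / 2 * deriv (c t) x ^ 2))
            + (∫ τ in (0:ℝ)..t, ∫ x in (0:ℝ)..1,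
                deriv (fun y => ∫ s in (1:ℝ)..(ρ τ y), μ / s ^ 2) x
                  * deriv (fun y => artificialPressure P γ (ρ τ y)) x)
          ≤ C (H1norm ρ₀) (H1norm u₀) M₀ μ κ γ W T₀) ∧
        (∀ t ∈ Set.Ico 0 T₀,
          L2norm (fun x => deriv (fun y => (Real.sqrt (ρ t y))⁻¹) x)
            ≤ C (H1norm ρ₀) (H1norm u₀) M₀ μ κ γ W T₀) := by
  refine ⟨fun Hρ Hu M μ κ γ W T =>
    effectiveEnergyBound (initialEnergyBound Hρ Hu M μ γ W) M κ γ T + 1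
      + (effectiveEnergyBound (initialEnergyBound Hρ Hu M μ γ W) M κ γ T
        + initialEnergyBound Hρ Hu M μ γ W) / μ ^ 2, ?_⟩
  intro μ κ γ M T β a P W ρ u c ρ₀ u₀ hμ hκ hγ hM hT hP hPW hsol hρ₀
  have hW := isPressureWithPotential hP hPW
  have h := hsol.isSmoothNSK hW
  have h0 : (0 : ℝ) ∈ Ico 0 T := ⟨le_rfl, hT⟩
  obtain rfl : ρ 0 = ρ₀ := funext hsol.init_rho
  obtain rfl : u 0 = u₀ := funext hsol.init_u
  set R : ℝ × ℝ → ℝ := fun p => ρ p.1 p.2 with hR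
  set U : ℝ × ℝ → ℝ := fun p => u p.1 p.2 with hU
  set Z : ℝ × ℝ → ℝ := fun p => c p.1 p.2 with hZ
  set V : ℝ × ℝ → ℝ := fun p => U p + effectiveDrift μ R p with hV
  set A := initialEnergyBound (H1norm (ρ 0)) (H1norm (u 0)) M μ γ W with hA
  have hVs : ContDiffOn ℝ (⊤ : ℕ∞) V (Ico 0 T ×ˢ univ) := h.vel.add h.contDiffOn_effectiveDrift
  have hMinv : (0 : ℝ) < M⁻¹ := inv_pos.2 hM
  have hWc : ContinuousOn W (Icc M⁻¹ M) := fun r hr =>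
    (hW.hasDerivW r (hMinv.trans_le hr.1)).continuousAt.continuousWithinAt
  have hWN : ∀ r ∈ Icc M⁻¹ M, W r ≤ sSup (W '' Icc M⁻¹ M) := fun r hr =>
    le_csSup (isCompact_Icc.bddAbove_image hWc) (mem_image_of_mem W hr)
  have hN0 : 0 ≤ sSup (W '' Icc M⁻¹ M) := by
    refine Real.sSup_nonneg ?_
    rintro _ ⟨r, hr, rfl⟩
    exact hW.nonnegW r (hMinv.trans_le hr.1)
  have hA0 : 0 ≤ A := by
    rw [hA, initialEnergyBound]
    positivity
  have hF0 : 0 ≤ effectiveEnergyBound A M κ γ T := by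
    rw [effectiveEnergyBound]
    positivity
  have hEu0 : ∫ x in (0 : ℝ)..1, energyDensity κ γ W R Z U (0, x) ≤ A :=
    h.integral_energyDensity_zero_le hT hκ hγ hW h.vel.continuousOn hM hρ₀ hWN
      (fun x => by nlinarith [sq_nonneg (U (0, x)), sq_nonneg (effectiveDrift μ R (0, x))])
      (H1norm_sq (ρ 0)).symm (H1norm_sq (u 0)).symm
  have hEv0 : ∫ x in (0 : ℝ)..1, energyDensity κ γ W R Z V (0, x) ≤ A :=
    h.integral_energyDensity_zero_le hT hκ hγ hW hVs.continuousOn hM hρ₀ hWN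
      (fun x => by
        simp only [hV]
        nlinarith [sq_nonneg (U (0, x) - effectiveDrift μ R (0, x))])
      (H1norm_sq (ρ 0)).symm (H1norm_sq (u 0)).symm
  have hmass0 : ∫ x in (0 : ℝ)..1, R (0, x) ≤ M := by
    have hcM : IntervalIntegrable (fun _ : ℝ => M) volume 0 1 := intervalIntegrable_const
    have := intervalIntegral.integral_mono_on zero_le_one
      ((continuousOn_slice h.rho.continuousOn h0).intervalIntegrable 0 1) hcM fun x _ => (hρ₀ x).2
    simpa using this
  have hdrift : ∀ t ∈ Ico 0 T, ∀ x,
      deriv (fun y => ∫ s in (1 : ℝ)..(ρ t y), μ / s ^ 2) x = effectiveDrift μ R (t, x) := by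
    intro t ht x
    have e : deriv (fun y => ∫ s in (1 : ℝ)..(ρ t y), μ / s ^ 2) x
        = μ / R (t, x) ^ 2 * spaceDeriv R (t, x) :=
      ((hasDerivAt_integral_div_sq μ (h.rho_pos (t, x))).comp x
        (hasDerivAt_spaceDeriv h.rho ht x)).deriv
    rw [e, effectiveDrift]
    ring
  have hpress : ∀ t ∈ Ico 0 T, ∀ x, deriv (fun y => artificialPressure P γ (ρ t y)) x
      = (deriv P (R (t, x)) + γ * R (t, x)) * spaceDeriv R (t, x) := fun t ht x =>
    ((hasDerivAt_artificialPressure γ hW (h.rho_pos (t, x))).comp x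
      (hasDerivAt_spaceDeriv h.rho ht x)).deriv
  have hmain := fun t (ht : t ∈ Ico 0 T) => h.effective_energy_le hμ hκ hγ hW
    (fun r hr => deriv_artificialPressure_nonneg hP hW hr) hA0 hM.le hEu0 hEv0 hmass0 ht
  have hextra : 0 ≤ (effectiveEnergyBound A M κ γ T + A) / μ ^ 2 := by positivity
  refine ⟨by positivity, fun t ht => ?_, fun t ht => ?_⟩
  · have hdiss : (∫ τ in (0 : ℝ)..t, ∫ x in (0 : ℝ)..1,
          deriv (fun y => ∫ s in (1 : ℝ)..(ρ τ y), μ / s ^ 2) x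
            * deriv (fun y => artificialPressure P γ (ρ τ y)) x)
        = ∫ τ in (0 : ℝ)..t, ∫ x in (0 : ℝ)..1, effectiveDrift μ R (τ, x) *
          ((deriv P (R (τ, x)) + γ * R (τ, x)) * spaceDeriv R (τ, x)) := by
      refine intervalIntegral.integral_congr fun τ hτ => ?_
      rw [uIcc_of_le ht.1] at hτ
      have hτ' : τ ∈ Ico 0 T := ⟨hτ.1, hτ.2.trans_lt ht.2⟩
      simp only [hdrift τ hτ', hpress τ hτ']
    rw [hdiss]
    simp only [hdrift t ht]
    have hb : _ ≤ effectiveEnergyBound A M κ γ T := (hmain t ht).1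
    refine (le_trans (le_of_eq ?_) hb).trans (by linarith)
    rfl
  · have hle : ∫ x in (0 : ℝ)..1, deriv (fun y => (Real.sqrt (ρ t y))⁻¹) x ^ 2
        ≤ (effectiveEnergyBound A M κ γ T + A) / μ ^ 2 := by
      have hev := continuousOn_slice (h.continuousOn_energyDensity hW hVs.continuousOn) ht
      have heu := continuousOn_slice (h.continuousOn_energyDensity hW h.vel.continuousOn) ht
      have hρc := continuousOn_slice h.rho.continuousOn ht
      have hρx := continuousOn_slice
        (contDiffOn_spaceDeriv (uniqueDiffOn_Ico 0 T) h.rho).continuousOn ht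
      have hsq : ∀ x, deriv (fun y => (Real.sqrt (ρ t y))⁻¹) x ^ 2
          = spaceDeriv R (t, x) ^ 2 / (4 * R (t, x) ^ 3) := fun x =>
        deriv_inv_sqrt_sq (hasDerivAt_spaceDeriv h.rho ht x) (h.rho_pos (t, x))
      have hpt : ∀ x, spaceDeriv R (t, x) ^ 2 / (4 * R (t, x) ^ 3)
          ≤ (energyDensity κ γ W R Z V (t, x) + energyDensity κ γ W R Z U (t, x)) / μ ^ 2 := by
        intro x
        have hpos := h.rho_pos (t, x)
        have h1 := h.rho_mul_effectiveDrift_sq_le hκ hγ hW (t, x)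
        have h2 : spaceDeriv R (t, x) ^ 2 / (4 * R (t, x) ^ 3)
            = R (t, x) * effectiveDrift μ R (t, x) ^ 2 / 4 / μ ^ 2 := by
          simp only [effectiveDrift]
          field_simp
        rw [h2]
        gcongr
        linarith
      have hc1 : Continuous fun x => spaceDeriv R (t, x) ^ 2 / (4 * R (t, x) ^ 3) :=
        (hρx.pow 2).div (continuous_const.mul (hρc.pow 3)) fun x =>
          mul_ne_zero four_ne_zero (pow_ne_zero 3 (h.rho_pos (t, x)).ne')
      have hsum : Continuous fun x =>
          energyDensity κ γ W R Z V (t, x) + energyDensity κ γ W R Z U (t, x) := hev.add heu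
      simp_rw [hsq]
      refine (intervalIntegral.integral_mono_on zero_le_one (hc1.intervalIntegrable 0 1)
        ((hsum.div_const (μ ^ 2)).intervalIntegrable 0 1) fun x _ => hpt x).trans ?_
      rw [intervalIntegral.integral_div, intervalIntegral.integral_add
        (hev.intervalIntegrable _ _) (heu.intervalIntegrable _ _)]
      have hb : _ ≤ effectiveEnergyBound A M κ γ T := (hmain t ht).1
      have hd := (hmain t ht).2
      have hEu := (h.integral_energyDensity_vel_le hμ hW ht).trans hEu0
      gcongr
      linarith
    have hnn : 0 ≤ ∫ x in (0 : ℝ)..1, deriv (fun y => (Real.sqrt (ρ t y))⁻¹) x ^ 2 :=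
      intervalIntegral.integral_nonneg zero_le_one fun x _ => sq_nonneg _
    rw [L2norm]
    refine Real.sqrt_le_iff.2 ⟨by positivity, ?_⟩
    nlinarith
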